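/- arXiv:2510.00889 — 2 statements merged into one kernel-verified Lean document; each statement's English description precedes it below -/
import Mathlib

section
/- Let r ≥ 3 and let (b_1, …, b_r) be a basis of F_r (i.e., there is an automorphism of F_r sending x_i to b_i for each i) which is RCR, meaning there is no letter p (a generator x_j or an inverse x_j⁻¹) such that for every i the reduced word of b_i begins with p and ends with p⁻¹. Then for each i, no primitivity-blocking word of F_r occurs as a contiguous subword (infix) of the reduced word of b_i. -/
/-- `FG r` is the free group `F_r` of rank `r`, with free generating set
`x_1, …, x_r` given by `FreeGroup.of 0, …, FreeGroup.of (r-1)`. -/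
abbrev FG (r : ℕ) := FreeGroup (Fin r)

/-- `|w|`, the length of the reduced word representing `w`. -/
def wordLength {r : ℕ} (w : FG r) : ℕ := w.toWord.length

/-- `w` is cyclically reduced: its reduced word is empty, or its first letter is not
the inverse of its last letter.  (A letter `(i, b)` has inverse `(i, !b)`.) -/
def CyclicallyReduced {r : ℕ} (w : FG r) : Prop :=
  ∀ a ∈ w.toWord.head?, ∀ b ∈ w.toWord.getLast?, a ≠ (b.1, !b.2)

/-- `p` is a primitive element of `F_r`: the image of `x_1` under some automorphism. -/
def Primitive {r : ℕ} (hr : 0 < r) (p : FG r) : Prop :=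
  ∃ φ : FG r ≃* FG r, φ (FreeGroup.of ⟨0, hr⟩) = p

/-- `v` is primitivity-blocking: the reduced word of `v` is not an infix of the reduced
word of any cyclically reduced primitive element of `F_r`. -/
def PrimitivityBlocking {r : ℕ} (hr : 0 < r) (v : FG r) : Prop :=
  ∀ p : FG r, Primitive hr p → CyclicallyReduced p → ¬ v.toWord <:+: p.toWord

/-- `v` is `w`-orbit-blocking: for every automorphism `φ` with `φ w` cyclically reduced,
the reduced word of `v` is not an infix of the reduced word of `φ w`. -/
def OrbitBlocking {r : ℕ} (w v : FG r) : Prop :=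
  ∀ φ : FG r ≃* FG r, CyclicallyReduced (φ w) → ¬ v.toWord <:+: (φ w).toWord

/-- `u` is positive: every letter of its reduced word is a generator (not an inverse). -/
def Positive {r : ℕ} (u : FG r) : Prop := ∀ l ∈ u.toWord, l.2 = true

/-- The cyclic length `‖u‖`: the minimum of `|g u g⁻¹|` over all `g`. -/
noncomputable def cyclicLength {r : ℕ} (u : FG r) : ℕ :=
  sInf (Set.range fun g : FG r => wordLength (g * u * g⁻¹))

/-- `gen r j` is the generator `x_{j+1}` of `F_r` (0-indexed: the `j`-th generator),
for `j < r`. -/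
def gen (r : ℕ) (j : ℕ) : FG r :=
  if h : j < r then FreeGroup.of ⟨j, h⟩ else 1

/-- `(b_1, …, b_r)` is a basis of `F_r`: some automorphism sends `x_i` to `b_i`. -/
def IsBasis {r : ℕ} (b : Fin r → FG r) : Prop :=
  ∃ φ : FG r ≃* FG r, ∀ i, φ (FreeGroup.of i) = b i

/-- The basis `b` is RCR: there is no letter `p` such that every `b_i` begins with `p`
and ends with `p⁻¹`. -/
def RCR {r : ℕ} (b : Fin r → FG r) : Prop :=
  ¬ ∃ p : Fin r × Bool, ∀ i,
    (b i).toWord.head? = some p ∧ (b i).toWord.getLast? = some (p.1, !p.2)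

namespace FreeGroup

variable {α : Type*} [DecidableEq α]

theorem toWord_mul_of_noncancelling {g h : FreeGroup α}
    (H : ∀ x ∈ g.toWord.getLast?, ∀ y ∈ h.toWord.head?, y ≠ (x.1, !x.2)) :
    (g * h).toWord = g.toWord ++ h.toWord := by
  rw [toWord_mul]
  refine IsReduced.reduce_eq (List.isChain_append.2 ⟨isReduced_toWord, isReduced_toWord, ?_⟩)
  intro x hx y hy hxy
  have := H x hx y hy
  rcases x with ⟨x, _ | _⟩ <;> rcases y with ⟨y, _ | _⟩ <;> simp_all

theorem head?_toWord_inv (g : FreeGroup α) :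
    g⁻¹.toWord.head? = g.toWord.getLast?.map fun x => (x.1, !x.2) := by
  simp [toWord_inv, invRev]

theorem getLast?_toWord_inv (g : FreeGroup α) :
    g⁻¹.toWord.getLast? = g.toWord.head?.map fun x => (x.1, !x.2) := by
  simp [toWord_inv, invRev]

theorem _root_.List.exists_common_prefix {β : Type*} (l m : List β) :
    ∃ p a b, l = p ++ a ∧ m = p ++ b ∧ ∀ x ∈ a.head?, ∀ y ∈ b.head?, x ≠ y := by
  induction l generalizing m with
  | nil => exact ⟨[], [], m, by simp⟩
  | cons x l ih =>
    cases m with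
    | nil => exact ⟨[], x :: l, [], by simp⟩
    | cons y m =>
      by_cases hxy : x = y
      · obtain ⟨p, a, b, rfl, rfl, h⟩ := ih m
        exact ⟨x :: p, a, b, by simp, by simp [hxy], h⟩
      · exact ⟨[], x :: l, y :: m, by simpa using hxy⟩

/-- Factoring the longest common prefix out of two elements. -/
theorem exists_common_prefix (g h : FreeGroup α) :
    ∃ k a b : FreeGroup α, g = k * a ∧ h = k * b ∧
      g.toWord = k.toWord ++ a.toWord ∧ h.toWord = k.toWord ++ b.toWord ∧
      (a⁻¹ * b).toWord = a⁻¹.toWord ++ b.toWord := by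
  obtain ⟨p, a, b, hg, hh, hab⟩ := List.exists_common_prefix g.toWord h.toWord
  have hp : IsReduced p := isReduced_toWord.infix (hg ▸ (List.prefix_append p a).isInfix)
  have ha : IsReduced a := isReduced_toWord.infix (hg ▸ (List.suffix_append p a).isInfix)
  have hb : IsReduced b := isReduced_toWord.infix (hh ▸ (List.suffix_append p b).isInfix)
  refine ⟨mk p, mk a, mk b, ?_, ?_, ?_, ?_, toWord_mul_of_noncancelling ?_⟩
  · rw [mul_mk, ← hg, mk_toWord]
  · rw [mul_mk, ← hh, mk_toWord]
  · rw [toWord_mk, toWord_mk, hp.reduce_eq, ha.reduce_eq, hg]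
  · rw [toWord_mk, toWord_mk, hp.reduce_eq, hb.reduce_eq, hh]
  · intro x hx y hy
    simp only [getLast?_toWord_inv, toWord_mk, ha.reduce_eq, Option.mem_def,
      Option.map_eq_some_iff] at hx
    obtain ⟨z, hz, rfl⟩ := hx
    rw [toWord_mk, hb.reduce_eq] at hy
    simpa using (hab z hz y hy).symm

theorem getLast?_eq_of_toWord_eq_append {g k a : FreeGroup α} (h : g.toWord = k.toWord ++ a.toWord)
    (ha : a ≠ 1) : g.toWord.getLast? = a.toWord.getLast? := by
  rw [h, List.getLast?_append_of_ne_nil _ (mt toWord_eq_nil_iff.1 ha)]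

theorem length_toWord_pos {g : FreeGroup α} (hg : g ≠ 1) : 0 < g.toWord.length :=
  List.length_pos_iff.2 (mt toWord_eq_nil_iff.1 hg)

/-- Multiplying by a power of `c` makes the last letter of `d` differ from `q`. -/
theorem exists_not_commute_getLast?_ne {H : Subgroup (FreeGroup α)} {q : α × Bool}
    {c : FreeGroup α} (hc : c ∈ H) (hcq : c.toWord.getLast? ≠ some q) (d : FreeGroup α)
    (hd : d ∈ H) (hcd : ¬ Commute c d) :
    ∃ d' ∈ H, ¬ Commute c d' ∧ d'.toWord.getLast? ≠ some q := by
  have hc1 : c ≠ 1 := fun h => hcd (h ▸ Commute.one_left d)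
  have hcdc : ¬ Commute c (d * c) := fun h => hcd (by
    simpa using h.mul_right (Commute.refl c).inv_right)
  obtain ⟨k, a, b, hk, hkb, hwd, hwc, hab⟩ := exists_common_prefix d⁻¹ c
  have hdc : d * c = a⁻¹ * b := by
    rw [← inv_inv d, hk, hkb]
    group
  by_cases hb : b = 1
  · have hlt : (d * c).toWord.length < d.toWord.length := by
      have h1 := congrArg List.length hwd
      have h2 : k = c := by rw [hkb, hb, mul_one]
      have h3 := length_toWord_pos hc1
      rw [hdc, hb, mul_one]
      simp only [toWord_inv, invRev_length, List.length_append, h2] at h1 ⊢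
      omega
    exact exists_not_commute_getLast?_ne hc hcq (d * c) (H.mul_mem hd hc) hcdc
  · refine ⟨d * c, H.mul_mem hd hc, hcdc, ?_⟩
    rwa [hdc, getLast?_eq_of_toWord_eq_append hab hb, ← getLast?_eq_of_toWord_eq_append hwc hb]
termination_by d.toWord.length

/-- A Euclidean algorithm on prefixes: two non-commuting elements not ending in `p⁻¹` generate a
nontrivial element that neither begins with `p` nor ends with `p⁻¹`. -/
theorem exists_head?_ne_getLast?_ne {H : Subgroup (FreeGroup α)} {p : α × Bool}
    (c d : FreeGroup α) (hc : c ∈ H) (hd : d ∈ H) (hcd : ¬ Commute c d)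
    (hcp : c.toWord.getLast? ≠ some (p.1, !p.2)) (hdp : d.toWord.getLast? ≠ some (p.1, !p.2)) :
    ∃ w ∈ H, w ≠ 1 ∧ w.toWord.head? ≠ some p ∧ w.toWord.getLast? ≠ some (p.1, !p.2) := by
  have hc1 : c ≠ 1 := fun h => hcd (h ▸ Commute.one_left d)
  have hd1 : d ≠ 1 := fun h => hcd (h ▸ Commute.one_right c)
  obtain ⟨k, a, b, hkc, hkd, hwc, hwd, hab⟩ := exists_common_prefix c d
  have hlc := congrArg List.length hwc
  have hld := congrArg List.length hwd
  rw [List.length_append] at hlc hld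
  by_cases ha : a = 1
  · have hk : k = c := by rw [hkc, ha, mul_one]
    have hbH : b ∈ H := by
      have : b = c⁻¹ * d := by rw [hkd, hk, inv_mul_cancel_left]
      exact this ▸ H.mul_mem (H.inv_mem hc) hd
    have hcb : ¬ Commute c b := fun h => hcd (by
      rw [hkd, hk]
      exact (Commute.refl c).mul_right h)
    have hb : b ≠ 1 := fun h => hcb (h ▸ Commute.one_right c)
    have hpos := length_toWord_pos hc1
    have hlt : b.toWord.length < d.toWord.length := by
      rw [hld, hk]
      omega
    exact exists_head?_ne_getLast?_ne c b hc hbH hcb hcp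
      (by rwa [← getLast?_eq_of_toWord_eq_append hwd hb])
  by_cases hb : b = 1
  · have hk : k = d := by rw [hkd, hb, mul_one]
    have haH : a ∈ H := by
      have : a = d⁻¹ * c := by rw [hkc, hk, inv_mul_cancel_left]
      exact this ▸ H.mul_mem (H.inv_mem hd) hc
    have had : ¬ Commute a d := fun h => hcd (by
      rw [hkc, hk]
      exact (Commute.refl d).mul_left h)
    have hpos := length_toWord_pos hd1
    have hlt : a.toWord.length < c.toWord.length := by
      rw [hlc, hk]
      omega
    exact exists_head?_ne_getLast?_ne a d haH hd had
      (by rwa [← getLast?_eq_of_toWord_eq_append hwc ha]) hdp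
  · refine ⟨a⁻¹ * b, ?_, ?_, ?_, ?_⟩
    · have : a⁻¹ * b = c⁻¹ * d := by
        rw [hkc, hkd]
        group
      exact this ▸ H.mul_mem (H.inv_mem hc) hd
    · intro h
      rw [h, toWord_one, eq_comm, List.append_eq_nil_iff, toWord_eq_nil_iff] at hab
      exact ha (inv_eq_one.1 hab.1)
    · rw [hab, List.head?_append_of_ne_nil _ (mt toWord_eq_nil_iff.1 (inv_ne_one.2 ha)),
        head?_toWord_inv, ← getLast?_eq_of_toWord_eq_append hwc ha]
      intro h
      obtain ⟨x, hx, rfl⟩ := Option.map_eq_some_iff.1 h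
      exact hcp (by simpa using hx)
    · rwa [getLast?_eq_of_toWord_eq_append hab hb, ← getLast?_eq_of_toWord_eq_append hwd hb]
termination_by c.toWord.length + d.toWord.length
decreasing_by all_goals omega

theorem exists_mem_head?_ne_getLast?_ne {H : Subgroup (FreeGroup α)} {p : α × Bool}
    {c d : FreeGroup α} (hc : c ∈ H) (hd : d ∈ H) (hcd : ¬ Commute c d)
    (hcp : ¬ (c.toWord.head? = some p ∧ c.toWord.getLast? = some (p.1, !p.2))) :
    ∃ w ∈ H, w ≠ 1 ∧ w.toWord.head? ≠ some p ∧ w.toWord.getLast? ≠ some (p.1, !p.2) := by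
  obtain ⟨c', hc', hcd', hcp'⟩ :
      ∃ c' ∈ H, ¬ Commute c' d ∧ c'.toWord.getLast? ≠ some (p.1, !p.2) := by
    by_cases h : c.toWord.getLast? = some (p.1, !p.2)
    · refine ⟨c⁻¹, H.inv_mem hc, by rwa [Commute.inv_left_iff], ?_⟩
      rw [getLast?_toWord_inv]
      intro h'
      obtain ⟨x, hx, hxp⟩ := Option.map_eq_some_iff.1 h'
      have : x = p := by
        simp only [Prod.mk.injEq, Bool.not_inj_iff] at hxp
        exact Prod.ext hxp.1 hxp.2
      exact hcp ⟨this ▸ hx, h⟩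
    · exact ⟨c, hc, hcd, h⟩
  obtain ⟨d', hd', hcd'', hdp⟩ := exists_not_commute_getLast?_ne hc' hcp' d hd hcd'
  exact exists_head?_ne_getLast?_ne c' d' hc' hd' hcd'' hcp' hdp

theorem not_commute_of {i j : α} (hij : i ≠ j) : ¬ Commute (of i) (of j) := by
  intro h
  have h' := congrArg toWord h.eq
  rw [toWord_mul_of_noncancelling (by simp), toWord_mul_of_noncancelling (by simp)] at h'
  simp [hij] at h'

/-- The transvection `of i ↦ of i * w`, for `w` in the span of the other generators. -/
theorem exists_mulEquiv_of_eq_mul (i : α) {w : FreeGroup α}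
    (hw : w ∈ Subgroup.closure (of '' {i}ᶜ)) :
    ∃ ψ : FreeGroup α ≃* FreeGroup α, ψ (of i) = of i * w := by
  let f (w : FreeGroup α) : FreeGroup α →* FreeGroup α := lift (Function.update of i (of i * w))
  have f_of (w) : f w (of i) = of i * w := by simp [f]
  have f_of_ne (w) {j} (hj : j ≠ i) : f w (of j) = of j := by simp [f, hj]
  have f_fix (v) : ∀ u ∈ Subgroup.closure (of '' {i}ᶜ), f v u = u := by
    intro u hu
    refine MonoidHom.eqOn_closure (f := f v) (g := MonoidHom.id _) ?_ hu
    rintro _ ⟨j, hj, rfl⟩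
    exact f_of_ne v hj
  have comp (u v) (hv : v ∈ Subgroup.closure (of '' {i}ᶜ)) (huv : u * v = 1) :
      (f u).comp (f v) = MonoidHom.id _ := by
    ext j
    by_cases hj : j = i
    · subst hj
      simp [f_of, f_fix u v hv, mul_assoc, huv]
    · simp [f_of_ne _ hj]
  exact ⟨(f w).toMulEquiv (f w⁻¹) (comp _ _ hw (inv_mul_cancel w))
    (comp _ _ (inv_mem hw) (mul_inv_cancel w)), f_of w⟩

end FreeGroup

open FreeGroup in
theorem primitive_apply_of {r : ℕ} (hr : 0 < r) (φ : FG r ≃* FG r) (i : Fin r) :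
    Primitive hr (φ (FreeGroup.of i)) :=
  ⟨(freeGroupCongr (Equiv.swap ⟨0, hr⟩ i)).trans φ, by simp⟩

/-- If `r ≥ 3` and `(b_1, …, b_r)` is an RCR basis of `F_r`, then no
primitivity-blocking word occurs as an infix of the reduced word of any `b_i`. -/
theorem no_pb_infix_of_RCR_basis {r : ℕ} (hr : 3 ≤ r) (b : Fin r → FG r)
    (hb : IsBasis b) (hc : RCR b) :
    ∀ i : Fin r, ∀ v : FG r, PrimitivityBlocking (by omega) v →
      ¬ v.toWord <:+: (b i).toWord := by
  intro i v hv hvi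
  obtain ⟨φ, hφ⟩ := hb
  have hr0 : 0 < r := by omega
  by_cases hcyc : CyclicallyReduced (b i)
  · exact hv _ (hφ i ▸ primitive_apply_of hr0 φ i) hcyc hvi
  obtain ⟨p, hp, hq⟩ : ∃ p, (b i).toWord.head? = some p ∧
      (b i).toWord.getLast? = some (p.1, !p.2) := by
    simp only [CyclicallyReduced, not_forall, not_not] at hcyc
    obtain ⟨_, hp, q, hq, rfl⟩ := hcyc
    exact ⟨_, hp, by simpa using hq⟩
  obtain ⟨j, hj⟩ := not_forall.1 (not_exists.1 hc p)
  have hji : j ≠ i := fun h => hj (h ▸ ⟨hp, hq⟩)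
  obtain ⟨k, hki, hkj⟩ := Fin.exists_ne_and_ne_of_two_lt i j hr
  set K := Subgroup.closure (FreeGroup.of '' ({i}ᶜ : Set (Fin r)))
  have hmem {l : Fin r} (hl : l ≠ i) : b l ∈ K.map φ.toMonoidHom :=
    ⟨_, Subgroup.subset_closure ⟨l, hl, rfl⟩, hφ l⟩
  have hjk : ¬ Commute (b j) (b k) := by
    rw [← hφ, ← hφ]
    intro h
    exact FreeGroup.not_commute_of hkj.symm (by simpa using h.map φ.symm)
  obtain ⟨_, ⟨u, hu, rfl⟩, hw1, hwp, hwq⟩ :=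
    FreeGroup.exists_mem_head?_ne_getLast?_ne (hmem hji) (hmem hki) hjk hj
  rw [MulEquiv.toMonoidHom_eq_coe, MonoidHom.coe_coe] at hw1 hwp hwq
  obtain ⟨ψ, hψ⟩ := FreeGroup.exists_mulEquiv_of_eq_mul i hu
  have hprim : Primitive hr0 (b i * φ u) := by
    have := primitive_apply_of hr0 (ψ.trans φ) i
    rwa [MulEquiv.trans_apply, hψ, map_mul, hφ] at this
  have hword : (b i * φ u).toWord = (b i).toWord ++ (φ u).toWord := by
    refine FreeGroup.toWord_mul_of_noncancelling fun x hx y hy => ?_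
    rw [hq, Option.mem_some_iff] at hx
    rintro rfl
    subst hx
    exact hwp (by simpa using hy)
  refine hv _ hprim ?_ (hword ▸ hvi.trans (List.prefix_append _ _).isInfix)
  intro x hx y hy hxy
  rw [hword, List.head?_append, hp, Option.some_or, Option.mem_some_iff] at hx
  rw [hword, List.getLast?_append_of_ne_nil _ (mt FreeGroup.toWord_eq_nil_iff.1 hw1)] at hy
  subst hx hxy
  exact hwq (by simpa using hy)
end

section
/- In the free group F_2, for every integer k ≥ 2, the word x_1^k x_2^k is primitivity-blocking. -/
namespace FreeGroup

variable {α : Type*}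

theorem IsReduced.invRev {L : List (α × Bool)} (h : IsReduced L) :
    IsReduced (FreeGroup.invRev L) := by
  classical
  rw [isReduced_iff_reduce_eq, reduce_invRev, h.reduce_eq]

theorem IsReduced.concat_or_concat {G : List (α × Bool)} (hG : IsReduced G) {s t : α × Bool}
    (hst : s ≠ t) : IsReduced (G ++ [s]) ∨ IsReduced (G ++ [t]) := by
  rcases G.eq_nil_or_concat with rfl | ⟨G', x, rfl⟩
  · simp
  · have key : ∀ y : α × Bool, (x.1 = y.1 → x.2 = y.2) → IsReduced (G' ++ [x] ++ [y]) :=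
      fun y hy ↦ IsReduced.append_overlap (by simpa using hG)
        (by simpa [IsReduced] using hy) (by simp)
    simp only [List.concat_eq_append] at *
    by_contra! hc
    have h1 := mt (key s) hc.1
    have h2 := mt (key t) hc.2
    obtain ⟨x1, x2⟩ := x
    obtain ⟨s1, s2⟩ := s
    obtain ⟨t1, t2⟩ := t
    cases x2 <;> cases s2 <;> cases t2 <;> simp_all

theorem norm_map_le {β : Type*} [DecidableEq β] (φ : FreeGroup α →* FreeGroup β) {C : ℕ}
    (hC : ∀ s : α × Bool, (φ (mk [s])).norm ≤ C) (L : List (α × Bool)) :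
    (φ (mk L)).norm ≤ C * L.length := by
  induction L with
  | nil => simp [← one_eq_mk]
  | cons x L ih =>
    have e : mk (x :: L) = mk [x] * mk L := by rw [mul_mk, List.singleton_append]
    rw [e, _root_.map_mul]
    refine (norm_mul_le _ _).trans ?_
    have := hC x
    simp only [List.length_cons]
    lia

variable [DecidableEq α]

theorem IsReduced.norm_mk {L : List (α × Bool)} (h : IsReduced L) : (mk L).norm = L.length := by
  rw [norm, toWord_mk, h.reduce_eq]

theorem toWord_mk_singleton_mul (x : α × Bool) (h : FreeGroup α) :
    (mk [x] * h).toWord = x :: h.toWord ∨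
      h.toWord = (x.1, !x.2) :: (mk [x] * h).toWord := by
  rw [toWord_mul, toWord_mk, reduce_singleton, List.singleton_append, reduce.cons, reduce_toWord]
  rcases h.toWord with _ | ⟨⟨y1, y2⟩, t⟩
  · simp
  · obtain ⟨x1, x2⟩ := x
    by_cases hc : x1 = y1 ∧ x2 = !y2
    · simp [hc.1, hc.2]
    · simp [hc]

/-- Left multiplication by an element shorter than `h` preserves the last letter of `h`. -/
theorem getLast?_toWord_mk_mul (L : List (α × Bool)) (h : FreeGroup α) (hL : L.length < h.norm) :
    (mk L * h).toWord.getLast? = h.toWord.getLast? ∧ h.norm ≤ L.length + (mk L * h).norm := by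
  induction L with
  | nil => simp [← one_eq_mk]
  | cons x L ih =>
    obtain ⟨ih1, ih2⟩ := ih (by simp at hL; lia)
    have e : mk (x :: L) * h = mk [x] * (mk L * h) := by
      rw [← mul_assoc, mul_mk, List.singleton_append]
    simp only [List.length_cons] at hL
    have hpos : 0 < (mk L * h).norm := by lia
    rw [e, ← ih1]
    rcases toWord_mk_singleton_mul x (mk L * h) with h1 | h1
    · have hne : (mk L * h).toWord ≠ [] := List.ne_nil_of_length_pos hpos
      refine ⟨?_, ?_⟩
      · rw [h1, List.getLast?_cons_of_ne_nil hne]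
      · have := congrArg List.length h1
        simp only [List.length_cons, norm] at *
        lia
    · have := congrArg List.length h1
      have hne : (mk [x] * (mk L * h)).toWord ≠ [] := by
        apply List.ne_nil_of_length_pos
        simp only [List.length_cons, norm] at *
        lia
      refine ⟨?_, ?_⟩
      · rw [h1, List.getLast?_cons_of_ne_nil hne]
      · simp only [List.length_cons, norm] at *
        lia

theorem getLast?_toWord_mul {u h : FreeGroup α} (hu : u.norm < h.norm) :
    (u * h).toWord.getLast? = h.toWord.getLast? := by
  simpa [mk_toWord] using (getLast?_toWord_mk_mul u.toWord h hu).1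

theorem getLast?_toWord_mk_singleton_mul_eq_some (x y : α × Bool) (hxy : x.1 ≠ y.1)
    (h : FreeGroup α) :
    (mk [x] * h).toWord.getLast? = some y ↔ h.toWord.getLast? = some y := by
  have hx : ∀ b, (x.1, b) ≠ y := fun b hb ↦ hxy (by rw [← hb])
  have hx' : x ≠ y := hx x.2
  rcases toWord_mk_singleton_mul x h with h1 | h1
  · rw [h1]
    rcases h.toWord with _ | ⟨z, t⟩ <;> simp [hx', List.getLast?_cons_cons]
  · rw [h1]
    rcases (mk [x] * h).toWord with _ | ⟨z, t⟩ <;> simp [hx, List.getLast?_cons_cons]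

theorem exists_norm_map_le [Finite α] {β : Type*} [DecidableEq β]
    (φ : FreeGroup α →* FreeGroup β) :
    ∃ C, ∀ g : FreeGroup α, (φ g).norm ≤ C * g.norm := by
  obtain ⟨C, hC⟩ := (Set.finite_range fun s : α × Bool ↦ (φ (mk [s])).norm).bddAbove
  refine ⟨C, fun g ↦ ?_⟩
  have := norm_map_le φ (fun s ↦ hC ⟨s, rfl⟩) g.toWord
  rwa [mk_toWord] at this

/-- `f` takes the constant value `c` on the elements of norm at least `N` whose reduced word
starts with `G`. -/
def ConstOnCone (f : FreeGroup α → Prop) (N : ℕ) (G : List (α × Bool)) (c : Prop) : Prop :=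
  ∀ T, IsReduced (G ++ T) → N ≤ (G ++ T).length → (f (mk (G ++ T)) ↔ c)

theorem constOnCone_of_le_length {f : FreeGroup α → Prop} {N : ℕ}
    (hf : ∀ (g : FreeGroup α) s, N ≤ g.norm → (f (g * mk [s]) ↔ f g)) {G : List (α × Bool)}
    (hG : N ≤ G.length) : ConstOnCone f N G (f (mk G)) := by
  intro T
  induction T using List.reverseRecOn with
  | nil => simp
  | append_singleton T x ih =>
    intro hr _
    rw [← List.append_assoc] at hr ⊢
    have hr' : IsReduced (G ++ T) := hr.infix ⟨[], [x], by simp⟩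
    rw [← mul_mk, hf _ _ (by rw [hr'.norm_mk, List.length_append]; lia),
      ih hr' (by rw [List.length_append]; lia)]

/-- If `f` is invariant under right multiplication by a cyclically reduced element `p`, and `yz`
is a cyclic subword of `p`, then `f` takes the same value on the cones at `Gy⁻¹` and `Gz`. -/
theorem ConstOnCone.iff_of_isInfix_append_self {f : FreeGroup α → Prop} {N : ℕ} {p : FreeGroup α}
    (hp : ∀ g, f (g * p) ↔ f g) (hc : IsCyclicallyReduced p.toWord)
    {y z : α × Bool} (hyz : [y, z] <:+: p.toWord ++ p.toWord) {G : List (α × Bool)}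
    (hy : IsReduced (G ++ [(y.1, !y.2)])) (hz : IsReduced (G ++ [z])) {c d : Prop}
    (h₁ : ConstOnCone f N (G ++ [(y.1, !y.2)]) c) (h₂ : ConstOnCone f N (G ++ [z]) d) :
    c ↔ d := by
  have hpow : ∀ (n : ℕ) g, f (g * p ^ n) ↔ f g := by
    intro n
    induction n with
    | zero => simp
    | succ n ih => intro g; rw [pow_succ, ← mul_assoc, hp, ih]
  obtain ⟨U, V, hUV⟩ := hyz
  set W := p.toWord with hW
  have hWne : W ≠ [] := by
    rintro h
    simp [h] at hUV
  have hWlen : 1 ≤ W.length := List.length_pos_of_ne_nil hWne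
  set P := (List.replicate N W).flatten with hP
  have hPlen : N ≤ P.length := by
    simp only [hP, List.length_flatten, List.map_replicate, List.sum_replicate, smul_eq_mul]
    nlinarith
  have hPp : mk P = p ^ N := by
    rw [hP, ← pow_mk, hW, mk_toWord]
  have hR1 : IsReduced (W ++ W ++ P) := by
    have := (hc.flatten_replicate (N + 2)).isReduced
    simpa [List.replicate_succ, ← hP] using this
  have hR2 : IsReduced (P ++ (W ++ W)) := by
    have := (hc.flatten_replicate (N + 2)).isReduced
    rw [List.replicate_add] at this
    simpa [List.replicate_succ, ← hP] using this
  have hr1 : IsReduced (G ++ [z] ++ (V ++ P)) :=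
    IsReduced.append_overlap hz
      (hR1.infix ⟨U ++ [y], [], by rw [← hUV]; simp⟩) (by simp)
  have hr2 : IsReduced (G ++ [(y.1, !y.2)] ++ (invRev U ++ invRev P)) := by
    refine IsReduced.append_overlap hy ?_ (by simp)
    have : IsReduced (P ++ U ++ [y]) := hR2.infix ⟨[], [z] ++ V, by rw [← hUV]; simp⟩
    simpa [invRev_append, invRev] using this.invRev
  have e1 := h₁ _ hr2 (by simp only [List.length_append, invRev_length]; lia)
  have e2 := h₂ _ hr1 (by simp only [List.length_append]; lia)
  have m1 : mk (G ++ [z] ++ (V ++ P)) = mk G * mk (z :: V) * p ^ N := by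
    rw [← hPp]
    simp
  have m2 : mk (G ++ [(y.1, !y.2)] ++ (invRev U ++ invRev P)) * p ^ N
      = mk G * (mk (U ++ [y]))⁻¹ := by
    rw [← hPp]
    have : mk (G ++ [(y.1, !y.2)] ++ (invRev U ++ invRev P))
      = mk G * (mk (U ++ [y]))⁻¹ * (mk P)⁻¹ := by
      simp [invRev]
    rw [this, inv_mul_cancel_right]
  have m3 : mk (U ++ [y]) * mk (z :: V) = p ^ 2 := by
    have : p ^ 2 = mk (W ++ W) := by rw [← mul_mk, hW, mk_toWord, pow_two]
    rw [this, ← hUV]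
    simp
  have m4 : mk G * mk (z :: V) = mk G * (mk (U ++ [y]))⁻¹ * p ^ 2 := by
    rw [← m3]; group
  rw [← e1, ← e2, m1, hpow, m4, hpow, ← m2, hpow]

end FreeGroup

theorem List.exists_infix_pair_ne_right {α : Type*} {x y : α} (hxy : x ≠ y) :
    ∀ L : List α, ∃ z, z ≠ x ∧ [x, z] <:+: x :: (L ++ [y])
  | [] => ⟨y, hxy.symm, [], [], rfl⟩
  | a :: L => by
    by_cases h : a = x
    · obtain ⟨z, hz, hi⟩ := exists_infix_pair_ne_right hxy L
      subst h
      exact ⟨z, hz, hi.trans ⟨[a], [], by simp⟩⟩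
    · exact ⟨a, h, [], L ++ [y], rfl⟩

theorem List.exists_infix_pair_ne_left {α : Type*} {x y : α} (hxy : x ≠ y) (L : List α) :
    ∃ z, z ≠ y ∧ [z, y] <:+: x :: (L ++ [y]) := by
  obtain ⟨z, hz, hi⟩ := exists_infix_pair_ne_right hxy.symm L.reverse
  exact ⟨z, hz, List.reverse_infix.1 (by simpa using hi)⟩

open FreeGroup in
/-- If a cyclically reduced `p` contains `x₁x₁x₂x₂`, then an eventually locally constant
right `p`-invariant property is eventually constant: the Whitehead graph of `p` is connected
without cut vertex. -/
theorem exists_constOnCone {f : FG 2 → Prop} {N : ℕ} {p : FG 2}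
    (hf : ∀ (g : FG 2) s, N ≤ g.norm → (f (g * mk [s]) ↔ f g))
    (hp : ∀ g, f (g * p) ↔ f g) (hc : IsCyclicallyReduced p.toWord)
    (hv : [(0, true), (0, true), (1, true), (1, true)] <:+: p.toWord)
    {G : List (Fin 2 × Bool)} (hG : IsReduced G) : ∃ c, ConstOnCone f N G c := by
  obtain hle | hlt := le_or_gt N G.length
  · exact ⟨_, constOnCone_of_le_length hf hle⟩
  have step : ∀ s, ∃ c, IsReduced (G ++ [s]) → ConstOnCone f N (G ++ [s]) c := fun s ↦ by
    by_cases hs : IsReduced (G ++ [s])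
    · obtain ⟨c, h⟩ := exists_constOnCone hf hp hc hv hs
      exact ⟨c, fun _ ↦ h⟩
    · exact ⟨True, fun h ↦ absurd h hs⟩
  choose c hcone using step
  have edge : ∀ y z, [y, z] <:+: p.toWord ++ p.toWord → IsReduced (G ++ [(y.1, !y.2)]) →
      IsReduced (G ++ [z]) → (c (y.1, !y.2) ↔ c z) := fun y z h h1 h2 ↦
    ConstOnCone.iff_of_isInfix_append_self hp hc h h1 h2 (hcone _ h1) (hcone _ h2)
  have hred : ∀ y z, [y, z] <:+: p.toWord ++ p.toWord → y.1 = z.1 → y.2 = z.2 := fun y z h ↦ by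
    have := (hc.flatten_replicate 2).isReduced
    exact List.isChain_pair.1 (this.infix (by simpa [List.replicate_succ] using h))
  obtain ⟨l, r, hlr⟩ := hv
  have hW2 : p.toWord ++ p.toWord = l ++ [(0, true), (0, true), (1, true)] ++
      ((1, true) :: ((r ++ l) ++ [(0, true)])) ++ ([(0, true), (1, true), (1, true)] ++ r) := by
    rw [← hlr]; simp
  have hsub : (1, true) :: ((r ++ l) ++ [(0, true)]) <:+: p.toWord ++ p.toWord := ⟨_, _, hW2.symm⟩
  have i1 : [((0 : Fin 2), true), (0, true)] <:+: p.toWord ++ p.toWord :=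
    ⟨l, [(1, true), (1, true)] ++ r ++ p.toWord, by rw [← hlr]; simp⟩
  have i2 : [((0 : Fin 2), true), (1, true)] <:+: p.toWord ++ p.toWord :=
    ⟨l ++ [(0, true)], [(1, true)] ++ r ++ p.toWord, by rw [← hlr]; simp⟩
  have i3 : [((1 : Fin 2), true), (1, true)] <:+: p.toWord ++ p.toWord :=
    ⟨l ++ [(0, true), (0, true)], r ++ p.toWord, by rw [← hlr]; simp⟩
  obtain ⟨u, hu, hui⟩ := List.exists_infix_pair_ne_right
    (show ((1 : Fin 2), true) ≠ (0, true) by decide) (r ++ l)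
  obtain ⟨v, hv', hvi⟩ := List.exists_infix_pair_ne_left
    (show ((1 : Fin 2), true) ≠ (0, true) by decide) (r ++ l)
  have hui := hui.trans hsub
  have hvi := hvi.trans hsub
  have hu0 : u.1 = 0 := by
    have := hred _ _ hui
    obtain ⟨u1, u2⟩ := u
    fin_cases u1 <;> simp_all
  have hv1 : v.1 = 1 := by
    have := hred _ _ hvi
    obtain ⟨v1, v2⟩ := v
    fin_cases v1 <;> simp_all
  have e1 := edge _ _ i1
  have e2 := edge _ _ i2
  have e3 := edge _ _ i3
  have e4 := edge _ _ hui
  have e5 := edge _ _ hvi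
  have o : ∀ s t, s ≠ t → _ := fun s t hst ↦ hG.concat_or_concat (s := s) (t := t) hst
  have all : ∀ s t, IsReduced (G ++ [s]) → IsReduced (G ++ [t]) → (c s ↔ c t) := by
    have o1 := o (0, true) (0, false) (by decide)
    have o2 := o (0, true) (1, true) (by decide)
    have o3 := o (0, true) (1, false) (by decide)
    have o4 := o (0, false) (1, true) (by decide)
    have o5 := o (0, false) (1, false) (by decide)
    have o6 := o (1, true) (1, false) (by decide)
    obtain ⟨u1, u2⟩ := u
    obtain ⟨v1, v2⟩ := v
    obtain rfl : u1 = 0 := hu0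
    obtain rfl : v1 = 1 := hv1
    clear hui hvi hu hv' o edge hcone hred hf hp i1 i2 i3 hsub hW2 hlr
    simp only [Bool.not_true] at e1 e2 e3 e4 e5
    rintro ⟨s1, s2⟩ ⟨t1, t2⟩
    fin_cases s1 <;> fin_cases t1 <;> cases s2 <;> cases t2 <;> cases u2 <;> cases v2 <;>
      simp only [Fin.zero_eta, Fin.mk_one, Bool.not_true, Bool.not_false] at * <;> grind
  obtain ⟨s, hs⟩ : ∃ s, IsReduced (G ++ [s]) := by
    rcases o (0, true) (0, false) (by decide) with h | h <;> exact ⟨_, h⟩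
  refine ⟨c s, fun T hT hlen ↦ ?_⟩
  rcases T with _ | ⟨t, T⟩
  · simp at hlen; lia
  · have e : G ++ t :: T = G ++ [t] ++ T := by simp
    rw [e] at hT hlen ⊢
    have ht : IsReduced (G ++ [t]) := hT.infix ⟨[], T, by simp⟩
    rw [hcone t ht T hT hlen, all s t hs ht]
termination_by N - G.length
decreasing_by simp; lia

open FreeGroup in
theorem Primitive.not_isInfix_toWord {p : FG 2} (hp : Primitive (by norm_num) p)
    (hc : IsCyclicallyReduced p.toWord) :
    ¬ [(0, true), (0, true), (1, true), (1, true)] <:+: p.toWord := by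
  intro hv
  obtain ⟨φ, rfl⟩ := hp
  let f : FG 2 → Prop := fun g ↦ (φ.symm g)⁻¹.toWord.getLast? = some (1, true)
  have hinv : ∀ g, f (g * φ (of 0)) ↔ f g := fun g ↦ by
    simp only [f, _root_.map_mul, MulEquiv.symm_apply_apply, mul_inv_rev]
    exact getLast?_toWord_mk_singleton_mul_eq_some (0, false) _ (by simp) _
  obtain ⟨C, hC⟩ := exists_norm_map_le φ.toMonoidHom
  obtain ⟨M, hM⟩ := exists_norm_map_le φ.symm.toMonoidHom
  simp only [MulEquiv.toMonoidHom_eq_coe, MonoidHom.coe_coe] at hC hM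
  have hf : ∀ (g : FG 2) s, C * M + 1 ≤ g.norm → (f (g * mk [s]) ↔ f g) := fun g s hg ↦ by
    simp only [f, _root_.map_mul, mul_inv_rev]
    rw [getLast?_toWord_mul]
    rw [norm_inv_eq, norm_inv_eq]
    have h1 : (φ.symm (mk [s])).norm ≤ M :=
      (hM _).trans (by rw [IsReduced.norm_mk (by simp)]; simp)
    have h2 := hC (φ.symm g)
    rw [MulEquiv.apply_symm_apply] at h2
    by_contra! h3
    have := Nat.mul_le_mul_left C (h3.trans h1)
    lia
  obtain ⟨c, hcc⟩ := exists_constOnCone hf hinv hc hv (G := []) (by simp)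
  have hconst : ∀ g : FG 2, C * M + 1 ≤ g.norm → (f g ↔ c) := fun g hg ↦ by
    simpa [mk_toWord] using hcc g.toWord (by simpa using isReduced_toWord)
      (by simpa [FreeGroup.norm] using hg)
  have hlong : ∀ h : FG 2, M * (C * M + 1) < h.norm → C * M + 1 ≤ (φ h).norm := fun h hh ↦ by
    have h2 := hM (φ h)
    rw [MulEquiv.symm_apply_apply] at h2
    by_contra! h3
    have := Nat.mul_le_mul_left M h3.le
    lia
  set n := M * (C * M + 1) with hn
  have t1 := hconst (φ (of 1 ^ (n + 1))⁻¹) (hlong _ (by simp))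
  have t2 := hconst (φ (of 0 ^ (n + 1))⁻¹) (hlong _ (by simp))
  simp only [f, MulEquiv.symm_apply_apply, inv_inv, toWord_of_pow, List.getLast?_replicate,
    Nat.add_eq_zero_iff, one_ne_zero, and_false, if_false] at t1 t2
  have := t1.trans t2.symm
  simp at this

open FreeGroup in
theorem CyclicallyReduced.isCyclicallyReduced {r : ℕ} {w : FG r} (h : CyclicallyReduced w) :
    IsCyclicallyReduced w.toWord := by
  refine ⟨isReduced_toWord, fun a ha b hb hab ↦ ?_⟩
  have := h b hb a ha
  by_contra hne
  exact this (Prod.ext hab.symm (Bool.eq_not_of_ne (Ne.symm hne)))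

/-- In `F_2`, the word `x_1^k x_2^k` is primitivity-blocking for every
`k ≥ 2`. -/
theorem pb_x1k_x2k_in_F2 (k : ℕ) (hk : 2 ≤ k) :
    PrimitivityBlocking (by norm_num)
      ((FreeGroup.of 0) ^ k * (FreeGroup.of 1) ^ k : FG 2) := by
  intro p hp hc hinf
  refine hp.not_isInfix_toWord hc.isCyclicallyReduced (List.IsInfix.trans ?_ hinf)
  obtain ⟨m, rfl⟩ := Nat.exists_eq_add_of_le hk
  have hred : FreeGroup.IsReduced (List.replicate (2 + m) ((0 : Fin 2), true) ++
      List.replicate (2 + m) (1, true)) := by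
    rw [FreeGroup.IsReduced, List.isChain_append]
    refine ⟨List.isChain_replicate_of_rel _ (by simp), List.isChain_replicate_of_rel _ (by simp),
      ?_⟩
    simp [List.getLast?_replicate, List.head?_replicate]
  rw [FreeGroup.toWord_mul, FreeGroup.toWord_of_pow, FreeGroup.toWord_of_pow, hred.reduce_eq]
  refine ⟨List.replicate m (0, true), List.replicate m (1, true), ?_⟩
  rw [List.replicate_add 2 m ((1 : Fin 2), true), add_comm 2 m, List.replicate_add m 2]
  simp [List.replicate_succ]
end
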